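/- Let K = 𝔽_q(T), q = p^t, P monic irreducible of degree d, α ∈ ℕ with gcd(α, p) = 1, and α₀ = ⌊α/p⌋. Fix an Artin–Schreier extension L = K(y) with y^p − y = f(T)/P^α, deg f ≤ dα, gcd(f, P) = 1. The number of elements z ∈ L with L = K(z) and z^p − z = g(T)/P^α for some g ∈ 𝔽_q[T] with deg g ≤ dα and gcd(g, P) = 1 is exactly (p−1)·q^{dα₀+1}; each such z has the form z = j·y + h(T)/P^{α₀} with j ∈ {1,…,p−1} and deg h ≤ dα₀. -/

import Mathlib

open Polynomial IntermediateField

section ArtinSchreier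

variable {K Ω : Type*} [Field K] [Field Ω] [Algebra K Ω]

theorem isSeparable_of_pow_sub_eq_algebraMap {p : ℕ} [CharP K p] {w : Ω} {a : K}
    (hw : w ^ p - w = algebraMap K Ω a) : IsSeparable K w := by
  have hsep : (X ^ p - X - C a : K[X]).Separable := by
    rw [separable_def]
    have : derivative (X ^ p - X - C a : K[X]) = -1 := by simp [derivative_X_pow]
    rw [this]
    exact isCoprime_one_right.neg_right
  exact hsep.of_dvd (minpoly.dvd K w (by simp [hw]))

/-- An element `w` with `w ^ p - w ∈ K` that is fixed by all automorphisms lies in `K`. -/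
theorem mem_bot_of_pow_sub_eq_of_forall_algEquiv {p : ℕ} [CharP K p] [Normal K Ω] {w : Ω} {a : K}
    (hw : w ^ p - w = algebraMap K Ω a) (hfix : ∀ σ : Ω ≃ₐ[K] Ω, σ w = w) :
    w ∈ (⊥ : IntermediateField K Ω) := by
  by_contra hmem
  obtain ⟨w', hne, hconj⟩ := (notMem_iff_exists_ne_and_isConjRoot
    (isSeparable_of_pow_sub_eq_algebraMap hw) (Normal.splits inferInstance w)).1 hmem
  obtain ⟨σ, hσ⟩ := isConjRoot_iff_exists_algEquiv.1 hconj.symm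
  exact hne (by rw [← hσ, hfix])

theorem algEquiv_pow_sub_eq {p : ℕ} {w : Ω} {a : K} (hw : w ^ p - w = algebraMap K Ω a)
    (σ : Ω ≃ₐ[K] Ω) : (σ w) ^ p - σ w = w ^ p - w := by
  rw [← map_pow, ← map_sub, hw, σ.commutes]

theorem algEquiv_eq_of_mem_adjoin_simple {y z : Ω} (hz : z ∈ K⟮y⟯) {σ τ : Ω ≃ₐ[K] Ω}
    (h : σ y = τ y) : σ z = τ z := by
  have hle : K⟮y⟯ ≤ IntermediateField.fixedField (Subgroup.zpowers (τ⁻¹ * σ)) := by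
    rw [adjoin_simple_le_iff, IntermediateField.mem_fixedField_iff]
    intro f hf
    have hs : τ⁻¹ * σ ∈ MulAction.stabilizer (Ω ≃ₐ[K] Ω) y := by
      rw [MulAction.mem_stabilizer_iff]
      change τ.symm (σ y) = y
      rw [h, AlgEquiv.symm_apply_apply]
    exact (Subgroup.zpowers_le.2 hs) hf
  have h2 := (IntermediateField.mem_fixedField_iff _ _).1 (hle hz) (τ⁻¹ * σ)
    (Subgroup.mem_zpowers _)
  change τ.symm (σ z) = z at h2
  rwa [AlgEquiv.symm_apply_eq] at h2

theorem algEquiv_pow_apply_of_apply_eq_add_natCast {σ : Ω ≃ₐ[K] Ω} {y : Ω} {c : ℕ}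
    (h : σ y = y + c) (m : ℕ) : (σ ^ m) y = y + m * c := by
  induction m with
  | zero => simp
  | succ m ih => rw [pow_succ', AlgEquiv.mul_apply, ih]; simp [h]; ring

theorem adjoin_natCast_mul_add_algebraMap {y : Ω} {j : ℕ} (hj : (j : K) ≠ 0) (u : K) :
    K⟮(j : Ω) * y + algebraMap K Ω u⟯ = K⟮y⟯ := by
  have hj' : (j : Ω) ≠ 0 := by
    rw [← map_natCast (algebraMap K Ω)]
    exact (_root_.map_ne_zero _).2 hj
  apply le_antisymm <;> rw [adjoin_simple_le_iff]
  · exact add_mem (mul_mem (_root_.natCast_mem _ j) (mem_adjoin_simple_self K y))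
      (_root_.algebraMap_mem _ u)
  · have hmem := mul_mem (inv_mem (IntermediateField.natCast_mem _ j))
      (sub_mem (mem_adjoin_simple_self K ((j : Ω) * y + algebraMap K Ω u))
        (IntermediateField.algebraMap_mem _ u))
    rwa [add_sub_cancel_right, inv_mul_cancel_left₀ hj'] at hmem

variable {p : ℕ} [Fact p.Prime] [CharP Ω p]

/-- In characteristic `p`, two elements with the same image under `x ↦ x ^ p - x` differ by an
element of the prime field. -/
theorem exists_eq_add_natCast_of_pow_sub_eq {x x' : Ω}
    (h : x' ^ p - x' = x ^ p - x) : ∃ n < p, x' = x + (n : Ω) := by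
  have hx : (x' - x) ^ p = x' - x := by
    rw [sub_pow_char]
    linear_combination h
  rw [← Subfield.mem_bot_iff_pow_eq_self Ω p, mem_bot_iff_intCast p] at hx
  obtain ⟨n, hn⟩ := hx
  have hp : (p : ℤ) ≠ 0 := by exact_mod_cast (Fact.out : p.Prime).ne_zero
  refine ⟨(n % p).toNat, ?_, ?_⟩
  · have := Int.emod_lt_of_pos n (b := (p : ℤ)) (by have := Int.natCast_nonneg p; omega)
    have := Int.emod_nonneg n hp
    omega
  · have h1 : ((n % p).toNat : Ω) = ((n % p : ℤ) : Ω) := by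
      rw [← Int.cast_natCast, Int.toNat_of_nonneg (Int.emod_nonneg n hp)]
    have h2 : ((n % p : ℤ) : Ω) = (n : Ω) :=
      (CharP.intCast_eq_intCast Ω p).2 (Int.mod_modEq n p)
    rw [h1, h2, hn]
    ring

/-- Two Artin–Schreier generators related by `z ∈ K(y)` satisfy `z = j y + u` with `j` in the prime
field and `u ∈ K`. -/
theorem exists_eq_natCast_mul_add_algebraMap [CharP K p] [Normal K Ω] {y z : Ω} {a b : K}
    (hy : y ^ p - y = algebraMap K Ω a) (hz : z ^ p - z = algebraMap K Ω b)
    (hybot : y ∉ (⊥ : IntermediateField K Ω)) (hmem : z ∈ K⟮y⟯) :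
    ∃ j < p, ∃ u : K, z = (j : Ω) * y + algebraMap K Ω u := by
  obtain ⟨σ, hσ⟩ : ∃ σ : Ω ≃ₐ[K] Ω, σ y ≠ y := by
    by_contra! hcon
    exact hybot (mem_bot_of_pow_sub_eq_of_forall_algEquiv hy hcon)
  obtain ⟨c, -, hc⟩ := exists_eq_add_natCast_of_pow_sub_eq (algEquiv_pow_sub_eq hy σ)
  obtain ⟨e, -, he⟩ := exists_eq_add_natCast_of_pow_sub_eq (algEquiv_pow_sub_eq hz σ)
  have hc0 : (c : Ω) ≠ 0 := by
    intro h0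
    exact hσ (by rw [hc, h0, add_zero])
  have hfrob (n : ℕ) : (n : Ω) ^ p = n := by
    have := map_natCast (frobenius Ω p) n
    rwa [frobenius_def] at this
  obtain ⟨j, hjp, hj⟩ := exists_eq_add_natCast_of_pow_sub_eq (p := p) (x := (0 : Ω))
    (x' := (e : Ω) / c) (by
      rw [div_pow, hfrob, hfrob]
      simp [(Fact.out : p.Prime).ne_zero])
  rw [zero_add, div_eq_iff hc0] at hj
  have hw : (z - j * y) ^ p - (z - j * y) = algebraMap K Ω (b - j * a) := by
    rw [sub_pow_char, mul_pow, hfrob, map_sub, map_mul, map_natCast, ← hy, ← hz]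
    ring
  have hbot : z - j * y ∈ (⊥ : IntermediateField K Ω) := by
    refine mem_bot_of_pow_sub_eq_of_forall_algEquiv hw fun τ => ?_
    obtain ⟨r, -, hr⟩ := exists_eq_add_natCast_of_pow_sub_eq (algEquiv_pow_sub_eq hy τ)
    obtain ⟨m, -, hm⟩ := exists_eq_add_natCast_of_pow_sub_eq (p := p) (x := (0 : Ω))
      (x' := (r : Ω) / c) (by
        rw [div_pow, hfrob, hfrob]
        simp [(Fact.out : p.Prime).ne_zero])
    rw [zero_add, div_eq_iff hc0] at hm
    have hτy : τ y = (σ ^ m) y := by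
      rw [hr, algEquiv_pow_apply_of_apply_eq_add_natCast hc, hm]
    have hτz := algEquiv_eq_of_mem_adjoin_simple hmem hτy
    rw [algEquiv_pow_apply_of_apply_eq_add_natCast he] at hτz
    rw [map_sub, map_mul, map_natCast, hτz, hr, hm, hj]
    ring
  obtain ⟨u, hu⟩ := IntermediateField.mem_bot.1 hbot
  exact ⟨j, hjp, u, by rw [hu]; ring⟩

end ArtinSchreier

section RationalFunctions

variable {F : Type*} [Field F]

local notation "ι" => algebraMap (Polynomial F) (RatFunc F)

/-- If `u ^ p - u` has denominator dividing `P ^ α`, then `u` has denominator dividing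
`P ^ (α / p)`. -/
theorem exists_eq_div_pow_of_pow_sub_eq {p α : ℕ} (hp : p.Prime) {P G : F[X]}
    (hP : Irreducible P) {u : RatFunc F} (hu : u ^ p - u = ι G / ι (P ^ α)) :
    ∃ h : F[X], u = ι h / ι (P ^ (α / p)) := by
  classical
  have hP0 : ι P ≠ 0 := by
    simpa using hP.ne_zero
  have hinj : Function.Injective (algebraMap F[X] (RatFunc F)) := RatFunc.algebraMap_injective F
  have hp2 := hp.two_le
  have hexists : ∃ n, α / p ≤ n ∧ ∃ s : F[X], ι s = u * ι P ^ n := by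
    refine ⟨α, Nat.div_le_self _ _, ?_⟩
    rw [← IsIntegrallyClosed.isIntegral_iff]
    refine ⟨X ^ p - C (P ^ (α * (p - 1))) * X - C (G * P ^ (α * (p - 1))), ?_, ?_⟩
    · rw [sub_sub]
      apply monic_X_pow_sub
      compute_degree!
    · obtain ⟨k, rfl⟩ : ∃ k, p = k + 1 := ⟨p - 1, by omega⟩
      simp only [eval₂_sub, eval₂_mul, eval₂_X_pow, eval₂_C, eval₂_X, Nat.add_sub_cancel]
      simp only [map_mul, map_pow] at hu ⊢
      rw [eq_div_iff (pow_ne_zero _ hP0)] at hu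
      rw [mul_pow, ← pow_mul, mul_add, mul_one, pow_add, ← hu]
      ring
  obtain ⟨hn, s, hs⟩ := Nat.find_spec hexists
  set n := Nat.find hexists
  rcases hn.eq_or_lt with heq | hlt
  · refine ⟨s, ?_⟩
    rw [heq, hs, map_pow, mul_div_cancel_right₀ _ (pow_ne_zero _ hP0)]
  · exfalso
    have hn0 : 0 < n := (Nat.zero_le _).trans_lt hlt
    have hαn : α < n * p := (Nat.div_lt_iff_lt_mul hp.pos).1 hlt
    obtain ⟨k, rfl⟩ : ∃ k, p = k + 1 := ⟨p - 1, by omega⟩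
    have hrel : s ^ (k + 1) = P ^ (n * k) * s + G * P ^ (n * (k + 1) - α) := by
      apply hinj
      simp only [map_add, map_mul, map_pow, hs] at hu ⊢
      rw [eq_div_iff (pow_ne_zero _ hP0)] at hu
      have : ι P ^ (n * (k + 1)) = ι P ^ α * ι P ^ (n * (k + 1) - α) := by
        rw [← pow_add]; congr 1; omega
      rw [← hu, mul_pow, ← pow_mul]
      linear_combination (u ^ (k + 1) - u) * this
    have hdvd : P ∣ s := by
      apply hP.prime.dvd_of_dvd_pow (n := k + 1)
      rw [hrel]
      refine dvd_add (Dvd.dvd.mul_right (dvd_pow_self P ?_) _)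
        (Dvd.dvd.mul_left (dvd_pow_self P ?_) _)
      · exact Nat.mul_ne_zero hn0.ne' (by omega)
      · omega
    obtain ⟨r, rfl⟩ := hdvd
    refine Nat.find_min hexists (m := n - 1) (Nat.sub_one_lt hn0.ne') ⟨Nat.le_sub_one_of_lt hlt, r, ?_⟩
    apply mul_left_cancel₀ hP0
    rw [← map_mul, hs]
    obtain ⟨l, hl⟩ := Nat.exists_eq_add_one.2 hn0
    rw [hl, Nat.add_sub_cancel]
    ring

/-- Clearing denominators in `u ^ p - u` for `u = h / P ^ (α / p)`. -/
theorem div_pow_pow_sub_eq_iff {p α : ℕ} {P G h : F[X]} (hP : P ≠ 0) :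
    (ι h / ι (P ^ (α / p))) ^ p - ι h / ι (P ^ (α / p)) = ι G / ι (P ^ α) ↔
      G = h ^ p * P ^ (α % p) - h * P ^ (α - α / p) := by
  have hP0 : ι P ≠ 0 := by simpa using hP
  have hle : α / p ≤ α := Nat.div_le_self _ _
  have h1 : ι P ^ α = ι P ^ (α / p * p) * ι P ^ (α % p) := by
    rw [← pow_add, mul_comm, Nat.div_add_mod]
  have h2 : ι P ^ α = ι P ^ (α / p) * ι P ^ (α - α / p) := by
    rw [← pow_add, Nat.add_sub_cancel' hle]
  have key : (ι h / ι (P ^ (α / p))) ^ p - ι h / ι (P ^ (α / p)) =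
      ι (h ^ p * P ^ (α % p) - h * P ^ (α - α / p)) / ι (P ^ α) := by
    simp only [map_sub, map_mul, map_pow]
    rw [sub_div, div_pow, ← pow_mul]
    congr 1
    · rw [h1, mul_div_mul_right _ _ (pow_ne_zero _ hP0)]
    · rw [h2, mul_div_mul_right _ _ (pow_ne_zero _ hP0)]
  rw [key, div_left_inj' (by rw [map_pow]; exact pow_ne_zero _ hP0), (RatFunc.algebraMap_injective F).eq_iff]
  exact eq_comm

theorem degree_pow_mul_pow_le {P h : F[X]} {m r n d : ℕ} (hh : h.degree ≤ (d : WithBot ℕ))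
    (hn : m * d + r * P.natDegree ≤ n) : (h ^ m * P ^ r).degree ≤ (n : WithBot ℕ) := by
  apply degree_le_of_natDegree_le
  have := natDegree_le_of_degree_le hh
  calc (h ^ m * P ^ r).natDegree ≤ (h ^ m).natDegree + (P ^ r).natDegree := natDegree_mul_le
    _ ≤ m * h.natDegree + r * P.natDegree := add_le_add natDegree_pow_le natDegree_pow_le
    _ ≤ m * d + r * P.natDegree := by gcongr
    _ ≤ n := hn

theorem degree_pow_mul_sub_mul_pow_le {p α : ℕ} {P h : F[X]}
    (hh : h.degree ≤ ((P.natDegree * (α / p) : ℕ) : WithBot ℕ)) :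
    (h ^ p * P ^ (α % p) - h * P ^ (α - α / p)).degree ≤
      ((P.natDegree * α : ℕ) : WithBot ℕ) := by
  refine (degree_sub_le _ _).trans (max_le ?_ ?_)
  · refine degree_pow_mul_pow_le hh (le_of_eq ?_)
    conv_rhs => rw [← Nat.div_add_mod α p]
    ring
  · rw [← pow_one h]
    refine degree_pow_mul_pow_le hh (le_of_eq ?_)
    conv_rhs => rw [← Nat.add_sub_cancel' (Nat.div_le_self α p)]
    ring

theorem degree_le_of_degree_pow_mul_sub_mul_pow_le {p α : ℕ} (hp : p.Prime) {P h : F[X]}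
    (hP : P ≠ 0) (hG : (h ^ p * P ^ (α % p) - h * P ^ (α - α / p)).degree ≤
      ((P.natDegree * α : ℕ) : WithBot ℕ)) :
    h.degree ≤ ((P.natDegree * (α / p) : ℕ) : WithBot ℕ) := by
  by_contra! hcon
  have hlt : P.natDegree * (α / p) < h.natDegree := by
    by_contra! hle
    exact hcon.not_ge (degree_le_of_natDegree_le hle)
  have hh : h ≠ 0 := by
    rintro rfl
    simp at hlt
  have h1 : (h ^ p * P ^ (α % p)).natDegree = p * h.natDegree + α % p * P.natDegree := by
    rw [natDegree_mul (pow_ne_zero _ hh) (pow_ne_zero _ hP), natDegree_pow, natDegree_pow]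
  have h2 : (h * P ^ (α - α / p)).natDegree = h.natDegree + (α - α / p) * P.natDegree := by
    rw [natDegree_mul hh (pow_ne_zero _ hP), natDegree_pow]
  have e1 : P.natDegree * α = p * (P.natDegree * (α / p)) + α % p * P.natDegree := by
    conv_lhs => rw [← Nat.div_add_mod α p]
    ring
  have e2 : P.natDegree * α = P.natDegree * (α / p) + (α - α / p) * P.natDegree := by
    conv_lhs => rw [← Nat.add_sub_cancel' (Nat.div_le_self α p)]
    ring
  obtain ⟨k, hk⟩ : ∃ k, p = k + 2 := ⟨p - 2, by have := hp.two_le; omega⟩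
  obtain ⟨e, he⟩ := Nat.exists_eq_add_of_lt hlt
  have h3 : p * h.natDegree =
      p * (P.natDegree * (α / p)) + (h.natDegree - P.natDegree * (α / p)) + (k + 1) * (e + 1) := by
    rw [he, show P.natDegree * (α / p) + e + 1 - P.natDegree * (α / p) = e + 1 by omega, hk]
    ring
  have h4 : 0 < (k + 1) * (e + 1) := by positivity
  have hdeg : (h * P ^ (α - α / p)).natDegree < (h ^ p * P ^ (α % p)).natDegree := by
    rw [h1, h2]
    omega
  have := natDegree_le_of_degree_le hG
  rw [natDegree_sub_eq_left_of_natDegree_lt hdeg, h1] at this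
  omega

theorem dvd_pow_mul_sub_mul_pow {p α : ℕ} (hp : p.Prime) (hα : ¬ p ∣ α) (P h : F[X]) :
    P ∣ h ^ p * P ^ (α % p) - h * P ^ (α - α / p) := by
  have hα0 : 0 < α := Nat.pos_of_ne_zero fun h0 => hα (h0 ▸ dvd_zero p)
  refine dvd_sub (Dvd.dvd.mul_left (dvd_pow_self P ?_) _)
    (Dvd.dvd.mul_left (dvd_pow_self P ?_) _)
  · exact fun h0 => hα (Nat.dvd_of_mod_eq_zero h0)
  · exact (Nat.sub_pos_of_lt (Nat.div_lt_self hα0 hp.one_lt)).ne'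

end RationalFunctions

theorem IsCoprime.not_dvd_of_irreducible {F : Type*} [Field F] {f P : F[X]} (hfP : IsCoprime f P)
    (hP : Irreducible P) : ¬ P ∣ f :=
  fun hdvd => hP.not_isUnit (hfP.isUnit_of_dvd' hdvd dvd_rfl)

theorem natCard_degreeLT (F : Type*) [Field F] [Fintype F] (n : ℕ) :
    Nat.card (degreeLT F n) = Fintype.card F ^ n := by
  rw [Nat.card_congr (degreeLTEquiv F n).toEquiv]
  simp

/-- Let `K = 𝔽_q(T)`, `q = p^t`, `P` monic irreducible of degree
`d`, `α ∈ ℕ` with `p ∤ α`, `α₀ = ⌊α/p⌋`.  Fix an Artin–Schreier extension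
`L = K(y)` with `y^p - y = f/P^α`, `deg f ≤ dα`, `gcd(f, P) = 1`.  The number of
elements `z ∈ L` with `L = K(z)` and `z^p - z = g/P^α` for some `g` with
`deg g ≤ dα`, `gcd(g, P) = 1`, is exactly `(p-1)·q^{dα₀+1}`; and each such `z`
has the form `z = j·y + h/P^{α₀}` with `j ∈ {1, …, p-1}` and `deg h ≤ dα₀`. -/
theorem stmt10 {p t : ℕ} (hp : p.Prime) (ht : 0 < t)
    (Fq : Type*) [Field Fq] [Fintype Fq] (hq : Fintype.card Fq = p ^ t)
    (P : Polynomial Fq) (hPmonic : P.Monic) (hPirr : Irreducible P)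
    (α : ℕ) (hα : ¬ p ∣ α)
    (f : Polynomial Fq) (hfdeg : f.degree ≤ ((P.natDegree * α : ℕ) : WithBot ℕ))
    (hfP : IsCoprime f P)
    (y : AlgebraicClosure (RatFunc Fq))
    (hy : y ^ p - y = algebraMap (RatFunc Fq) (AlgebraicClosure (RatFunc Fq))
      (algebraMap (Polynomial Fq) (RatFunc Fq) f /
        algebraMap (Polynomial Fq) (RatFunc Fq) (P ^ α))) :
    Nat.card {z : AlgebraicClosure (RatFunc Fq) //
        IntermediateField.adjoin (RatFunc Fq) {z} =
          IntermediateField.adjoin (RatFunc Fq) {y} ∧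
        ∃ g : Polynomial Fq, g.degree ≤ ((P.natDegree * α : ℕ) : WithBot ℕ) ∧
          IsCoprime g P ∧
          z ^ p - z = algebraMap (RatFunc Fq) (AlgebraicClosure (RatFunc Fq))
            (algebraMap (Polynomial Fq) (RatFunc Fq) g /
              algebraMap (Polynomial Fq) (RatFunc Fq) (P ^ α))} =
      (p - 1) * Fintype.card Fq ^ (P.natDegree * (α / p) + 1) ∧
    ∀ z : AlgebraicClosure (RatFunc Fq),
      IntermediateField.adjoin (RatFunc Fq) {z} =
          IntermediateField.adjoin (RatFunc Fq) {y} →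
      (∃ g : Polynomial Fq, g.degree ≤ ((P.natDegree * α : ℕ) : WithBot ℕ) ∧
          IsCoprime g P ∧
          z ^ p - z = algebraMap (RatFunc Fq) (AlgebraicClosure (RatFunc Fq))
            (algebraMap (Polynomial Fq) (RatFunc Fq) g /
              algebraMap (Polynomial Fq) (RatFunc Fq) (P ^ α))) →
      ∃ (j : ℕ) (h : Polynomial Fq), 1 ≤ j ∧ j ≤ p - 1 ∧
        h.degree ≤ ((P.natDegree * (α / p) : ℕ) : WithBot ℕ) ∧
        z = (j : AlgebraicClosure (RatFunc Fq)) * y +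
          algebraMap (RatFunc Fq) (AlgebraicClosure (RatFunc Fq))
            (algebraMap (Polynomial Fq) (RatFunc Fq) h /
              algebraMap (Polynomial Fq) (RatFunc Fq) (P ^ (α / p))) := by
  have : Fact p.Prime := ⟨hp⟩
  have : CharP Fq p := charP_of_card_eq_prime_pow hq
  have : CharP (RatFunc Fq) p := charP_of_injective_algebraMap' Fq p
  have : CharP (AlgebraicClosure (RatFunc Fq)) p := charP_of_injective_algebraMap' (RatFunc Fq) p
  have hP0 : P ≠ 0 := hPirr.ne_zero
  have hinj : Function.Injective (algebraMap (RatFunc Fq) (AlgebraicClosure (RatFunc Fq))) :=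
    (algebraMap (RatFunc Fq) (AlgebraicClosure (RatFunc Fq))).injective
  have hybot : y ∉ (⊥ : IntermediateField (RatFunc Fq) (AlgebraicClosure (RatFunc Fq))) := by
    intro hmem
    obtain ⟨u, rfl⟩ := IntermediateField.mem_bot.1 hmem
    rw [← map_pow, ← map_sub, hinj.eq_iff] at hy
    obtain ⟨h, rfl⟩ := exists_eq_div_pow_of_pow_sub_eq hp hPirr hy
    rw [div_pow_pow_sub_eq_iff hP0] at hy
    exact hfP.not_dvd_of_irreducible hPirr (hy ▸ dvd_pow_mul_sub_mul_pow hp hα P h)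
  have hfrob (n : ℕ) : (n : AlgebraicClosure (RatFunc Fq)) ^ p = n := by
    have := map_natCast (frobenius (AlgebraicClosure (RatFunc Fq)) p) n
    rwa [frobenius_def] at this
  have hcast {j : ℕ} (h1 : 1 ≤ j) (h2 : j ≤ p - 1) (R : Type _) [Ring R] [CharP R p] :
      (j : R) ≠ 0 := by
    rw [Ne, CharP.cast_eq_zero_iff R p]
    intro hdvd
    have := Nat.le_of_dvd h1 hdvd
    have := hp.pos
    omega
  have hform : ∀ z : AlgebraicClosure (RatFunc Fq),
      IntermediateField.adjoin (RatFunc Fq) {z} =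
          IntermediateField.adjoin (RatFunc Fq) {y} →
      (∃ g : Polynomial Fq, g.degree ≤ ((P.natDegree * α : ℕ) : WithBot ℕ) ∧
          IsCoprime g P ∧
          z ^ p - z = algebraMap (RatFunc Fq) (AlgebraicClosure (RatFunc Fq))
            (algebraMap (Polynomial Fq) (RatFunc Fq) g /
              algebraMap (Polynomial Fq) (RatFunc Fq) (P ^ α))) →
      ∃ (j : ℕ) (h : Polynomial Fq), 1 ≤ j ∧ j ≤ p - 1 ∧
        h.degree ≤ ((P.natDegree * (α / p) : ℕ) : WithBot ℕ) ∧
        z = (j : AlgebraicClosure (RatFunc Fq)) * y +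
          algebraMap (RatFunc Fq) (AlgebraicClosure (RatFunc Fq))
            (algebraMap (Polynomial Fq) (RatFunc Fq) h /
              algebraMap (Polynomial Fq) (RatFunc Fq) (P ^ (α / p))) := by
    rintro z hadj ⟨g, hgdeg, -, hz⟩
    obtain ⟨j, hjp, u, rfl⟩ := exists_eq_natCast_mul_add_algebraMap hy hz hybot
      (hadj ▸ mem_adjoin_simple_self _ z)
    have hj1 : 1 ≤ j := by
      by_contra! hj0
      obtain rfl : j = 0 := by omega
      rw [Nat.cast_zero, zero_mul, zero_add,
        adjoin_simple_eq_bot_iff.2 (IntermediateField.algebraMap_mem _ u)] at hadj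
      exact hybot (adjoin_simple_eq_bot_iff.1 hadj.symm)
    have hu : u ^ p - u = algebraMap (Polynomial Fq) (RatFunc Fq) (g - (j : Fq[X]) * f) /
        algebraMap (Polynomial Fq) (RatFunc Fq) (P ^ α) := by
      apply hinj
      rw [map_sub (algebraMap Fq[X] (RatFunc Fq)), map_mul (algebraMap Fq[X] (RatFunc Fq)),
        map_natCast, sub_div, mul_div_assoc, map_sub, map_sub, ← hz, map_mul, map_natCast, ← hy,
        add_pow_char, mul_pow, hfrob, map_pow]
      ring
    obtain ⟨h, rfl⟩ := exists_eq_div_pow_of_pow_sub_eq hp hPirr hu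
    rw [div_pow_pow_sub_eq_iff hP0] at hu
    refine ⟨j, h, hj1, by omega, degree_le_of_degree_pow_mul_sub_mul_pow_le hp hP0 ?_, rfl⟩
    rw [← hu]
    refine (degree_sub_le _ _).trans (max_le hgdeg ?_)
    rw [← nsmul_eq_mul]
    exact (degree_smul_le _ _).trans hfdeg
  refine ⟨?_, hform⟩
  have hcard : Nat.card (Fin (p - 1) × degreeLT Fq (P.natDegree * (α / p) + 1)) =
      (p - 1) * Fintype.card Fq ^ (P.natDegree * (α / p) + 1) := by
    rw [Nat.card_prod, natCard_degreeLT, Nat.card_eq_fintype_card, Fintype.card_fin]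
  have hdegLT {h : Fq[X]} : h ∈ degreeLT Fq (P.natDegree * (α / p) + 1) ↔
      h.degree ≤ ((P.natDegree * (α / p) : ℕ) : WithBot ℕ) := by
    rw [mem_degreeLT, ← mem_degreeLE]
    rw [← degreeLT_succ_eq_degreeLE, mem_degreeLT]
  rw [← hcard]
  symm
  refine Nat.card_eq_of_bijective (fun x => ⟨((x.1 + 1 : ℕ) : AlgebraicClosure (RatFunc Fq)) * y +
    algebraMap (RatFunc Fq) (AlgebraicClosure (RatFunc Fq))
      (algebraMap (Polynomial Fq) (RatFunc Fq) x.2 /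
        algebraMap (Polynomial Fq) (RatFunc Fq) (P ^ (α / p))), ?_, ?_⟩) ⟨?_, ?_⟩
  · exact adjoin_natCast_mul_add_algebraMap (hcast (by omega) (by omega) _) _
  · obtain ⟨i, h, hh⟩ := x
    rw [hdegLT] at hh
    refine ⟨((i + 1 : ℕ) : Fq[X]) * f + (h ^ p * P ^ (α % p) - h * P ^ (α - α / p)), ?_, ?_, ?_⟩
    · refine (degree_add_le _ _).trans (max_le ?_ (degree_pow_mul_sub_mul_pow_le hh))
      rw [← nsmul_eq_mul]
      exact (degree_smul_le _ _).trans hfdeg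
    · obtain ⟨r, hr⟩ := dvd_pow_mul_sub_mul_pow hp hα P h
      rw [hr]
      refine IsCoprime.add_mul_left_left (IsCoprime.mul_left ?_ hfP) r
      have hunit : IsUnit ((i + 1 : ℕ) : Fq[X]) := by
        rw [← C_eq_natCast, isUnit_C]
        exact (hcast (by omega) (by omega) Fq).isUnit
      obtain ⟨v, hv⟩ := hunit.exists_left_inv
      exact ⟨v, 0, by rw [hv, zero_mul, add_zero]⟩
    · rw [map_add (algebraMap Fq[X] (RatFunc Fq)), map_mul (algebraMap Fq[X] (RatFunc Fq)),
        map_natCast, add_div, mul_div_assoc, ← (div_pow_pow_sub_eq_iff hP0).2 rfl, map_add, map_mul,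
        map_natCast, ← hy, add_pow_char, mul_pow, hfrob,
        map_sub (algebraMap (RatFunc Fq) _), map_pow (algebraMap (RatFunc Fq) _)]
      ring
  · rintro ⟨i, h, hh⟩ ⟨i', h', hh'⟩ heq
    simp only [Subtype.mk.injEq] at heq
    have hi : i = i' := by
      by_contra hne
      have hne' : ((i + 1 : ℕ) : AlgebraicClosure (RatFunc Fq)) - ((i' + 1 : ℕ)) ≠ 0 := by
        rw [sub_ne_zero, Ne, CharP.natCast_eq_natCast _ p]
        intro hmod
        have := hmod.eq_of_lt_of_lt (by omega) (by omega)
        exact hne (Fin.ext (by omega))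
      apply hybot
      have hyeq := (eq_div_iff hne').2 (show y * _ = algebraMap (RatFunc Fq) _
        (algebraMap (Polynomial Fq) (RatFunc Fq) h' /
          algebraMap (Polynomial Fq) (RatFunc Fq) (P ^ (α / p)) -
        algebraMap (Polynomial Fq) (RatFunc Fq) h /
          algebraMap (Polynomial Fq) (RatFunc Fq) (P ^ (α / p))) by
            rw [map_sub]
            linear_combination heq)
      rw [hyeq]
      exact div_mem (IntermediateField.algebraMap_mem _ _)
        (sub_mem (IntermediateField.natCast_mem _ _) (IntermediateField.natCast_mem _ _))
    subst hi
    have h2 := hinj (add_left_cancel heq)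
    rw [div_left_inj' (by simp [hP0]), (RatFunc.algebraMap_injective Fq).eq_iff] at h2
    subst h2
    rfl
  · rintro ⟨z, hadj, hg⟩
    obtain ⟨j, h, hj1, hj2, hh, hz⟩ := hform z hadj hg
    refine ⟨(⟨j - 1, by omega⟩, ⟨h, hdegLT.2 hh⟩), Subtype.ext ?_⟩
    simp only [Nat.sub_add_cancel hj1]
    exact hz.symm
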